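/- arXiv:2404.10672 — 2 statements merged into one kernel-verified Lean document; each statement's English description precedes it below -/
import Mathlib

section
/- Let p = (p_1,…,p_m), q = (q_1,…,q_n), r = (r_1,…,r_k) be vectors of positive integers, let G = C_{p:q:r} be the associated compact graph of type 3, and let i ≥ 1 be an integer. Then the number of vertex subsets W ⊆ V(G) such that the induced subgraph of G on W is a compact graph of type 3 (i.e. having exactly three vertices of degree at least 3) with exactly i+2 minimal cycles equals Σ_{a+b+c=i+1, a≥1, b≥1, c≥1} C(m,a)·C(n,b)·C(k,c), where C(·,·) denotes the binomial coefficient. -/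
open CategoryTheory MvPolynomial Finset
open scoped Classical

noncomputable section

namespace Paper

/-- The monomial `x_u * x_v` associated to an unordered pair `{u, v}` of vertices. -/
def edgeMon (K : Type*) [CommRing K] {V : Type*} (e : Sym2 V) : MvPolynomial V K :=
  Sym2.lift ⟨fun u v => X u * X v, fun u v => mul_comm _ _⟩ e

/-- The `K`-algebra map `K[E(G)] → K[V(G)]` sending the variable of an edge `{u,v}` to
`x_u * x_v`. -/
def edgeHom (K : Type*) [CommRing K] {V : Type*} (G : SimpleGraph V) :
    MvPolynomial G.edgeSet K →ₐ[K] MvPolynomial V K :=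
  aeval (fun e => edgeMon K (e : Sym2 V))

/-- The toric ideal of a simple graph. -/
def toricIdeal (K : Type*) [CommRing K] {V : Type*} (G : SimpleGraph V) :
    Ideal (MvPolynomial G.edgeSet K) :=
  RingHom.ker (edgeHom K G).toRingHom

/-- The edge ring `K[G] = K[E(G)]/I_G`. -/
abbrev edgeRing (K : Type*) [CommRing K] {V : Type*} (G : SimpleGraph V) :=
  MvPolynomial G.edgeSet K ⧸ toricIdeal K G

open CategoryTheory.Limits in
/-- The projective dimension of a module, as an element of `ℕ∞`:  the least `n` such that `M`
admits a projective resolution vanishing in homological degrees `> n` (or `⊤` if there is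
no such finite resolution). -/
def projDim (R : Type*) [CommRing R] (M : ModuleCat R) : ℕ∞ :=
  sInf {n : ℕ∞ | ∃ m : ℕ, (m : ℕ∞) = n ∧
    ∃ P : ProjectiveResolution M, ∀ i : ℕ, m < i → IsZero (P.complex.X i)}

/-- The 0-1 vector `ε_u + ε_v` attached to an unordered pair `{u,v}` with `u ≠ v`. -/
def edgeVec {V : Type*} (e : Sym2 V) : V → ℝ :=
  fun v => if v ∈ e then 1 else 0

/-- The edge cone of a finite simple graph: all nonnegative real combinations of the vectors
`v_e = ε_u + ε_v`, for `e = {u,v}` an edge of `G`. -/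
def edgeCone {V : Type*} [Fintype V] (G : SimpleGraph V) : Set (V → ℝ) :=
  {x | ∃ a : Sym2 V → ℝ, (∀ e, 0 ≤ a e) ∧ (∀ e, e ∉ G.edgeSet → a e = 0) ∧
    x = ∑ e : Sym2 V, a e • edgeVec e}

/-- A vector has integer coordinates. -/
def IsIntegralVec {V : Type*} (x : V → ℝ) : Prop := ∀ v, ∃ n : ℤ, x v = n

/-- A minimal vector of `relint(ℝ₊(G)) ∩ ℤ^{V(G)}`. -/
def IsMinimalVec {V : Type*} [Fintype V] (G : SimpleGraph V) (x : V → ℝ) : Prop :=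
  x ∈ intrinsicInterior ℝ (edgeCone G) ∧ IsIntegralVec x ∧
    ¬ ∃ y z : V → ℝ, (y ∈ intrinsicInterior ℝ (edgeCone G) ∧ IsIntegralVec y) ∧
      (z ∈ edgeCone G ∧ IsIntegralVec z ∧ z ≠ 0) ∧ x = y + z

/-! ### Multi-path graphs.  `c i` is the number of interior vertices of the `i`-th path,
so the `i`-th path has length `c i + 1`. -/

/-- Vertices of the multi-path graph: `Sum.inl 0 = v1`, `Sum.inl 1 = v2`, and
`Sum.inr ⟨i, j⟩ = u_{i,j+1}`, the `(j+1)`-st interior vertex of the `i`-th path. -/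
abbrev MPV {m : ℕ} (c : Fin m → ℕ) : Type := Fin 2 ⊕ (Σ i : Fin m, Fin (c i))

def mpRel {m : ℕ} (c : Fin m → ℕ) : MPV c → MPV c → Prop
  | Sum.inl a, Sum.inr ⟨i, j⟩ => (a = 0 ∧ (j : ℕ) = 0) ∨ (a = 1 ∧ (j : ℕ) + 1 = c i)
  | Sum.inr ⟨i, j⟩, Sum.inr ⟨i', j'⟩ => (i : ℕ) = i' ∧ (j' : ℕ) = (j : ℕ) + 1
  | _, _ => False

/-- The multi-path graph with `m` paths, the `i`-th of which has `c i` interior vertices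
(hence length `c i + 1`), all starting at `v1 = Sum.inl 0` and ending at `v2 = Sum.inl 1`. -/
def multiPath {m : ℕ} (c : Fin m → ℕ) : SimpleGraph (MPV c) :=
  SimpleGraph.fromRel (mpRel c)

/-! ### The two-ear graph `G_m` and the one-ear graph `P_m`. -/

/-- Vertices of the two-ear graph:  `Sum.inl 0 = v1`, `Sum.inl 1 = v2`, `Sum.inl 2 = x1`,
`Sum.inl 3 = x2`, `Sum.inl 4 = y1`, `Sum.inl 5 = y2`, and `Sum.inr i = u_{i+1}`. -/
abbrev TEV (m : ℕ) : Type := Fin 6 ⊕ Fin (m - 1)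

def teRel (m : ℕ) : TEV m → TEV m → Prop
  | Sum.inl a, Sum.inl b =>
      (a = 0 ∧ b = 2) ∨ (a = 0 ∧ b = 3) ∨ (a = 2 ∧ b = 3) ∨ (a = 1 ∧ b = 4) ∨
      (a = 1 ∧ b = 5) ∨ (a = 4 ∧ b = 5) ∨ (a = 2 ∧ b = 4)
  | Sum.inl a, Sum.inr _ => a = 0 ∨ a = 1
  | _, _ => False

/-- The two-ear graph `𝐆_m`. -/
def twoEar (m : ℕ) : SimpleGraph (TEV m) := SimpleGraph.fromRel (teRel m)

/-- The one-ear graph `𝐏_m`, the induced subgraph of `𝐆_m` on the complement of `x2`. -/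
def oneEar (m : ℕ) : SimpleGraph ({v : TEV m | v ≠ Sum.inl 3} : Set (TEV m)) :=
  (twoEar m).induce {v : TEV m | v ≠ Sum.inl 3}

/-! ### Cycles, the odd-cycle condition, and compact graphs. -/

/-- The odd-cycle condition: any two vertex-disjoint odd cycles are joined by an edge. -/
def OddCycleCondition {V : Type*} (G : SimpleGraph V) : Prop :=
  ∀ (a b : V) (c₁ : G.Walk a a) (c₂ : G.Walk b b), c₁.IsCycle → c₂.IsCycle →
    Odd c₁.length → Odd c₂.length →
    (∀ x, x ∈ c₁.support → x ∉ c₂.support) →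
    ∃ x ∈ c₁.support, ∃ y ∈ c₂.support, G.Adj x y

/-- `G` has no even cycle. -/
def HasNoEvenCycle {V : Type*} (G : SimpleGraph V) : Prop :=
  ∀ (a : V) (c : G.Walk a a), c.IsCycle → ¬ Even c.length

/-- A compact graph: connected, all degrees at least `2`, no even cycle, and the
odd-cycle condition holds. -/
def IsCompactGraph {V : Type*} (G : SimpleGraph V) : Prop :=
  G.Connected ∧ (∀ v : V, 2 ≤ (G.neighborSet v).ncard) ∧ HasNoEvenCycle G ∧ OddCycleCondition G

/-- The number `t(G)` of minimal (= induced) cycles of `G`, counted via their vertex sets. -/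
def cycleCount {V : Type*} (G : SimpleGraph V) : ℕ :=
  Set.ncard {S : Set V | ∃ (a : V) (c : G.Walk a a), c.IsCycle ∧
    (∀ x y, x ∈ c.support → y ∈ c.support → G.Adj x y → s(x, y) ∈ c.edges) ∧
    S = {x | x ∈ c.support}}


/-- Vertices of the compact graph of type 3, `C_{p:q:r}`:  the three big vertices
`u = Sum.inl 0`, `v = Sum.inl 1`, `w = Sum.inl 2` form a triangle; the remaining vertices
are the interiors of the odd cycles through `u`, `v` and `w` respectively. -/
abbrev CV {m n k : ℕ} (p : Fin m → ℕ) (q : Fin n → ℕ) (r : Fin k → ℕ) : Type :=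
  Fin 3 ⊕ ((Σ i : Fin m, Fin (2 * p i)) ⊕
    ((Σ i : Fin n, Fin (2 * q i)) ⊕ (Σ i : Fin k, Fin (2 * r i))))

def cRel {m n k : ℕ} (p : Fin m → ℕ) (q : Fin n → ℕ) (r : Fin k → ℕ) :
    CV p q r → CV p q r → Prop
  | Sum.inl a, Sum.inl b => ((a : ℕ) + 1 = (b : ℕ)) ∨ (a = 0 ∧ b = 2)
  | Sum.inl a, Sum.inr (Sum.inl ⟨i, j⟩) => a = 0 ∧ ((j : ℕ) = 0 ∨ (j : ℕ) + 1 = 2 * p i)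
  | Sum.inl a, Sum.inr (Sum.inr (Sum.inl ⟨i, j⟩)) =>
      a = 1 ∧ ((j : ℕ) = 0 ∨ (j : ℕ) + 1 = 2 * q i)
  | Sum.inl a, Sum.inr (Sum.inr (Sum.inr ⟨i, j⟩)) =>
      a = 2 ∧ ((j : ℕ) = 0 ∨ (j : ℕ) + 1 = 2 * r i)
  | Sum.inr (Sum.inl ⟨i, j⟩), Sum.inr (Sum.inl ⟨i', j'⟩) =>
      (i : ℕ) = i' ∧ (j' : ℕ) = (j : ℕ) + 1
  | Sum.inr (Sum.inr (Sum.inl ⟨i, j⟩)), Sum.inr (Sum.inr (Sum.inl ⟨i', j'⟩)) =>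
      (i : ℕ) = i' ∧ (j' : ℕ) = (j : ℕ) + 1
  | Sum.inr (Sum.inr (Sum.inr ⟨i, j⟩)), Sum.inr (Sum.inr (Sum.inr ⟨i', j'⟩)) =>
      (i : ℕ) = i' ∧ (j' : ℕ) = (j : ℕ) + 1
  | _, _ => False

/-- The compact graph of type 3, `C_{p:q:r}`. -/
def typeThree {m n k : ℕ} (p : Fin m → ℕ) (q : Fin n → ℕ) (r : Fin k → ℕ) :
    SimpleGraph (CV p q r) :=
  SimpleGraph.fromRel (cRel p q r)

/-! ### A uniform model: a triangle with ears. -/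

abbrev EV {I : Type} (L : I → ℕ) : Type := Fin 3 ⊕ (Σ x : I, Fin (L x))

def eAdj {I : Type} (L : I → ℕ) (base : I → Fin 3) : EV L → EV L → Prop
  | Sum.inl a, Sum.inl b => a ≠ b
  | Sum.inl a, Sum.inr z => base z.1 = a ∧ ((z.2 : ℕ) = 0 ∨ (z.2 : ℕ) + 1 = L z.1)
  | Sum.inr z, Sum.inl a => base z.1 = a ∧ ((z.2 : ℕ) = 0 ∨ (z.2 : ℕ) + 1 = L z.1)
  | Sum.inr z, Sum.inr z' => z.1 = z'.1 ∧
      ((z'.2 : ℕ) = (z.2 : ℕ) + 1 ∨ (z.2 : ℕ) = (z'.2 : ℕ) + 1)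

def eGraph {I : Type} (L : I → ℕ) (base : I → Fin 3) : SimpleGraph (EV L) where
  Adj := eAdj L base
  symm := ⟨by
    rintro (a | ⟨x, i⟩) (b | ⟨y, j⟩) h
    · exact fun h' => h h'.symm
    · exact h
    · exact h
    · obtain ⟨h1, h2⟩ := h
      exact ⟨h1.symm, h2.symm⟩⟩
  loopless := ⟨by
    rintro (a | ⟨x, i⟩) h
    · exact h rfl
    · obtain ⟨h1, h2⟩ := h
      omega⟩

section model
variable {I : Type} {L : I → ℕ} {base : I → Fin 3}

def prv (base : I → Fin 3) (x : I) (j : Fin (L x)) : EV L :=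
  if (j : ℕ) = 0 then Sum.inl (base x) else Sum.inr ⟨x, ⟨j - 1, by omega⟩⟩

def nxt (base : I → Fin 3) (x : I) (j : Fin (L x)) : EV L :=
  if h : (j : ℕ) + 1 = L x then Sum.inl (base x) else Sum.inr ⟨x, ⟨j + 1, by omega⟩⟩

lemma eAdj_ear (x : I) (j : Fin (L x)) (z : EV L) :
    (eGraph L base).Adj (Sum.inr ⟨x, j⟩) z ↔ z = prv base x j ∨ z = nxt base x j := by
  change eAdj L base _ _ ↔ _
  rcases z with a | ⟨y, i⟩
  · simp only [eAdj, prv, nxt]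
    split_ifs <;> simp <;> grind
  · simp only [eAdj, prv, nxt]
    constructor
    · rintro ⟨h, h'⟩
      subst h
      rcases h' with h' | h'
      · right
        rw [dif_neg (by omega)]
        congr 2
        exact Fin.ext h'
      · left
        rw [if_neg (by omega)]
        congr 2
        apply Fin.ext
        simp only
        omega
    · rintro (h | h)
      · split_ifs at h with h0
        obtain ⟨rfl, h2⟩ := Sigma.mk.inj (Sum.inr.inj h)
        obtain rfl := eq_of_heq h2
        refine ⟨rfl, ?_⟩
        simp only
        omega
      · split_ifs at h with h0
        obtain ⟨rfl, h2⟩ := Sigma.mk.inj (Sum.inr.inj h)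
        obtain rfl := eq_of_heq h2
        refine ⟨rfl, ?_⟩
        simp

lemma prv_ne_nxt (hL : ∀ x, 2 ≤ L x) (x : I) (j : Fin (L x)) : prv base x j ≠ nxt base x j := by
  have := hL x
  simp only [prv, nxt]
  split_ifs
  · omega
  · simp
  · simp
  · intro h
    obtain ⟨-, h2⟩ := Sigma.mk.inj (Sum.inr.inj h)
    have := congrArg Fin.val (eq_of_heq h2)
    simp at this

lemma ear_nbr (x : I) (j : Fin (L x)) :
    (eGraph L base).neighborSet (Sum.inr ⟨x, j⟩) = {prv base x j, nxt base x j} := by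
  ext z
  simp [eAdj_ear]

lemma ear_deg (hL : ∀ x, 2 ≤ L x) (x : I) (j : Fin (L x)) :
    ((eGraph L base).neighborSet (Sum.inr ⟨x, j⟩)).ncard = 2 := by
  rw [ear_nbr, Set.ncard_pair (prv_ne_nxt hL x j)]

/-- Any set closed under the two ear-neighbours that meets an ear contains the ear and base. -/
lemma ear_closed (S : Set (EV L)) (x : I) (j : Fin (L x))
    (hj : Sum.inr ⟨x, j⟩ ∈ S)
    (hS : ∀ j : Fin (L x), Sum.inr ⟨x, j⟩ ∈ S → prv base x j ∈ S ∧ nxt base x j ∈ S) :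
    Sum.inl (base x) ∈ S ∧ ∀ j : Fin (L x), Sum.inr ⟨x, j⟩ ∈ S := by
  have down : ∀ (a : ℕ) (ha : a < L x), Sum.inr ⟨x, ⟨a, ha⟩⟩ ∈ S →
      ∀ (b : ℕ) (hb : b ≤ a), Sum.inr ⟨x, ⟨b, by omega⟩⟩ ∈ S := by
    intro a
    induction a with
    | zero =>
      intro ha h b hb
      obtain rfl : b = 0 := by omega
      exact h
    | succ a ih =>
      intro ha h b hb
      rcases Nat.lt_or_ge a b with h1 | h1
      · obtain rfl : b = a + 1 := by omega
        exact h
      · refine ih (by omega) ?_ b h1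
        have := (hS _ h).1
        simpa [prv] using this
  have h0 := down j.1 j.2 hj 0 (by omega)
  have up : ∀ (a : ℕ) (ha : a < L x), Sum.inr ⟨x, ⟨a, ha⟩⟩ ∈ S := by
    intro a
    induction a with
    | zero => intro ha; exact h0
    | succ a ih =>
      intro ha
      have := (hS _ (ih (by omega))).2
      rw [nxt, dif_neg (by simp only; omega)] at this
      exact this
  refine ⟨?_, fun j => up j.1 j.2⟩
  have := (hS _ h0).1
  simpa [prv] using this

/-- The vertex set of the cycle given by an ear. -/
def earSet (L : I → ℕ) (base : I → Fin 3) (x : I) : Set (EV L) :=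
  insert (Sum.inl (base x)) (Set.range fun j : Fin (L x) => (Sum.inr ⟨x, j⟩ : EV L))

def triSet (L : I → ℕ) : Set (EV L) := Set.range Sum.inl

lemma earSet_ncard (x : I) : (earSet L base x).ncard = L x + 1 := by
  rw [earSet, Set.ncard_insert_of_notMem (by simp)]
  · rw [← Set.image_univ, Set.ncard_image_of_injective, Set.ncard_univ, Nat.card_fin]
    intro a b h
    simpa using h
  
lemma triSet_ncard : (triSet L).ncard = 3 := by
  rw [triSet, ← Set.image_univ, Set.ncard_image_of_injective _ Sum.inl_injective, Set.ncard_univ,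
    Nat.card_fin]

/-- number of vertices of a cycle -/
lemma cycle_ncard {V : Type*} {G : SimpleGraph V} {a : V} {c : G.Walk a a} (hc : c.IsCycle) :
    {x | x ∈ c.support}.ncard = c.length := by
  have h1 : {x | x ∈ c.support} = (c.support.tail.toFinset : Set V) := by
    ext x
    simp only [Set.mem_ofPred_eq, List.coe_toFinset]
    constructor
    · intro h
      rcases c.mem_support_iff.1 h with rfl | h
      · exact SimpleGraph.Walk.end_mem_tail_support hc.not_nil
      · exact h
    · exact List.mem_of_mem_tail
  rw [h1, Set.ncard_coe_finset, List.toFinset_card_of_nodup hc.support_nodup]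
  simp

lemma cycle_nbr {V : Type*} {G : SimpleGraph V} {a : V} {c : G.Walk a a} (hc : c.IsCycle) {v : V}
    (hv : v ∈ c.support) (y z : V) (h : ∀ w, w ∈ c.support → G.Adj v w → w = y ∨ w = z) :
    c.toSubgraph.neighborSet v = {y, z} := by
  have h2 := hc.ncard_neighborSet_toSubgraph_eq_two hv
  apply Set.eq_of_subset_of_ncard_le
  · intro w hw
    exact h w (c.mem_verts_toSubgraph.1 (c.toSubgraph.edge_vert hw.symm)) (c.toSubgraph.adj_sub hw)
  · rw [h2]
    exact (Set.ncard_insert_le _ _).trans (by simp)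
  · exact Set.toFinite _

lemma conn_closed {V : Type*} {G : SimpleGraph V} {a : V} (c : G.Walk a a) (S : Set V) {v : V}
    (hv : v ∈ c.support) (hvS : v ∈ S)
    (hS : ∀ x ∈ S, ∀ y, c.toSubgraph.Adj x y → y ∈ S) : ∀ x ∈ c.support, x ∈ S := by
  intro x hx
  have hcon := c.toSubgraph_connected
  have hr := hcon.coe.preconnected ⟨v, c.mem_verts_toSubgraph.2 hv⟩
    ⟨x, c.mem_verts_toSubgraph.2 hx⟩
  have key : ∀ (p q : c.toSubgraph.verts), c.toSubgraph.coe.Reachable p q → p.1 ∈ S → q.1 ∈ S := by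
    rintro p q ⟨w⟩
    induction w with
    | nil => exact id
    | cons h w ih => exact fun hp => ih (hS _ hp _ h)
  exact key _ _ hr hvS

/-- Classification of the cycles of the model. -/
lemma cycle_class (hL : ∀ x, 2 ≤ L x) {a : EV L} {c : (eGraph L base).Walk a a} (hc : c.IsCycle) :
    {z | z ∈ c.support} = triSet L ∨ ∃ x, {z | z ∈ c.support} = earSet L base x := by
  by_cases h : ∃ x j, (Sum.inr ⟨x, j⟩ : EV L) ∈ c.support
  · right
    obtain ⟨x, j, hj⟩ := h
    refine ⟨x, ?_⟩
    have hn : ∀ j : Fin (L x), (Sum.inr ⟨x, j⟩ : EV L) ∈ c.support →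
        c.toSubgraph.neighborSet (Sum.inr ⟨x, j⟩) = {prv base x j, nxt base x j} :=
      fun j hj => cycle_nbr hc hj _ _ fun w _ hw => (eAdj_ear x j w).1 hw
    have hmem : ∀ v w, c.toSubgraph.Adj v w → w ∈ c.support := fun v w h =>
      c.mem_verts_toSubgraph.1 (c.toSubgraph.edge_vert h.symm)
    obtain ⟨hb, he⟩ := ear_closed (base := base) {z | z ∈ c.support} x j hj (by
      intro j hj
      have := hn j hj
      constructor
      · apply hmem (Sum.inr ⟨x, j⟩)
        rw [← SimpleGraph.Subgraph.mem_neighborSet, this]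
        simp
      · apply hmem (Sum.inr ⟨x, j⟩)
        rw [← SimpleGraph.Subgraph.mem_neighborSet, this]
        simp)
    have hx := hL x
    have hbase : c.toSubgraph.neighborSet (Sum.inl (base x)) =
        {Sum.inr ⟨x, ⟨0, by omega⟩⟩, Sum.inr ⟨x, ⟨L x - 1, by omega⟩⟩} := by
      symm
      apply Set.eq_of_subset_of_ncard_le
      · intro w hw
        rw [SimpleGraph.Subgraph.mem_neighborSet]
        apply SimpleGraph.Subgraph.Adj.symm
        rw [← SimpleGraph.Subgraph.mem_neighborSet]
        rcases hw with rfl | hw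
        · rw [hn _ (he _)]
          simp [prv]
        · rw [Set.mem_singleton_iff] at hw
          subst hw
          rw [hn _ (he _)]
          right
          rw [nxt, dif_pos (by simp only; omega)]
          rfl
      · rw [hc.ncard_neighborSet_toSubgraph_eq_two hb, Set.ncard_pair]
        intro h
        simp at h
        omega
      · exact Set.finite_of_ncard_ne_zero (by
          rw [hc.ncard_neighborSet_toSubgraph_eq_two hb]; simp)
    ext z
    constructor
    · intro hz
      refine conn_closed c (earSet L base x) hb (by simp [earSet]) ?_ z hz
      rintro v hv y hy
      rcases hv with rfl | ⟨j, rfl⟩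
      · rw [← SimpleGraph.Subgraph.mem_neighborSet, hbase] at hy
        rcases hy with rfl | rfl <;> simp [earSet]
      · rw [← SimpleGraph.Subgraph.mem_neighborSet, hn j (he j)] at hy
        rcases hy with rfl | rfl
        · simp only [earSet, prv]
          split_ifs <;> simp
        · simp only [earSet, nxt]
          split_ifs <;> simp
    · rintro (rfl | ⟨j, rfl⟩)
      · exact hb
      · exact he j
  · left
    apply Set.eq_of_subset_of_ncard_le
    · rintro (b | ⟨x, j⟩) hz
      · exact ⟨b, rfl⟩
      · exact absurd ⟨x, j, hz⟩ h
    · rw [triSet_ncard, cycle_ncard hc]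
      exact hc.three_le_length
    · exact Set.finite_range _

lemma cycle_induced {V : Type*} {G : SimpleGraph V} {a : V} {c : G.Walk a a} (hc : c.IsCycle)
    (h : ∀ v ∈ c.support, ∃ y z, ∀ w, w ∈ c.support → G.Adj v w → w = y ∨ w = z) :
    ∀ x y, x ∈ c.support → y ∈ c.support → G.Adj x y → s(x, y) ∈ c.edges := by
  intro x y hx hy hxy
  obtain ⟨p, q, hpq⟩ := h x hx
  have := cycle_nbr hc hx p q hpq
  have hy' : y ∈ c.toSubgraph.neighborSet x := by
    rw [this]
    exact hpq y hy hxy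
  rw [SimpleGraph.Subgraph.mem_neighborSet, ← SimpleGraph.Subgraph.mem_edgeSet] at hy'
  exact c.mem_edges_toSubgraph.1 hy'

lemma cycleGraph_step {n : ℕ} {u v : Fin (n + 3)} (h : (SimpleGraph.cycleGraph (n + 3)).Adj u v) :
    (u : ℕ) + 1 = v ∨ (v : ℕ) + 1 = u ∨ ((u : ℕ) = 0 ∧ (v : ℕ) = n + 2) ∨
      ((v : ℕ) = 0 ∧ (u : ℕ) = n + 2) := by
  rw [SimpleGraph.cycleGraph_adj'] at h
  have hu := u.2
  have hv := v.2
  have key : ∀ a b : Fin (n + 3), ((a - b : Fin (n + 3)) : ℕ) = 1 →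
      (b : ℕ) + 1 = a ∨ ((a : ℕ) = 0 ∧ (b : ℕ) = n + 2) := by
    intro a b h
    have ha := a.2
    have hb := b.2
    rcases le_or_gt b a with h1 | h1
    · rw [Fin.sub_val_of_le h1] at h
      omega
    · rw [Fin.coe_sub_iff_lt.2 h1] at h
      omega
  rcases h with h | h <;> have := key _ _ h <;> omega

lemma exists_cycle_of_hom {V : Type*} {G : SimpleGraph V} {n : ℕ} (f : Fin (n + 3) → V)
    (hf : Function.Injective f)
    (hadj : ∀ u v, (SimpleGraph.cycleGraph (n + 3)).Adj u v → G.Adj (f u) (f v)) :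
    ∃ (a : V) (c : G.Walk a a), c.IsCycle ∧ {x | x ∈ c.support} = Set.range f := by
  let F : SimpleGraph.cycleGraph (n + 3) →g G := ⟨f, fun {a b} h => hadj a b h⟩
  refine ⟨_, (SimpleGraph.cycleGraph.cycle n).map F,
    (SimpleGraph.cycleGraph.isCycle_cycle).map hf, ?_⟩
  have hc := (SimpleGraph.cycleGraph.isCycle_cycle (n := n)).map (f := F) hf
  apply Set.eq_of_subset_of_ncard_le
  · intro x hx
    simp only [Set.mem_ofPred_eq, SimpleGraph.Walk.support_map, List.mem_map] at hx
    obtain ⟨y, -, rfl⟩ := hx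
    exact ⟨y, rfl⟩
  · rw [cycle_ncard hc, ← Set.image_univ, Set.ncard_image_of_injective _ hf, Set.ncard_univ,
      Nat.card_fin, SimpleGraph.Walk.length_map, SimpleGraph.cycleGraph.length_cycle]
  · exact Set.finite_range _

lemma exists_ear_cycle (hL : ∀ x, 2 ≤ L x) (x : I) :
    ∃ (a : EV L) (c : (eGraph L base).Walk a a), c.IsCycle ∧
    (∀ x y, x ∈ c.support → y ∈ c.support → (eGraph L base).Adj x y → s(x, y) ∈ c.edges) ∧
    earSet L base x = {x | x ∈ c.support} := by
  have hx := hL x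
  obtain ⟨n, hn⟩ : ∃ n, L x = n + 2 := ⟨L x - 2, by omega⟩
  let f : Fin (n + 3) → EV L := fun j =>
    if h : (j : ℕ) = 0 then Sum.inl (base x) else Sum.inr ⟨x, ⟨j - 1, by omega⟩⟩
  have hf : Function.Injective f := by
    intro a b h
    simp only [f] at h
    split_ifs at h
    · apply Fin.ext; omega
    · simp at h
      apply Fin.ext; omega
  obtain ⟨a, c, hc, hs⟩ := exists_cycle_of_hom (G := eGraph L base) f hf (by
    intro u v h
    have h := cycleGraph_step h
    change eAdj L base _ _
    simp only [f]
    split_ifs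
    · omega
    · simp only [eAdj]
      exact ⟨trivial, by omega⟩
    · simp only [eAdj]
      exact ⟨trivial, by omega⟩
    · simp only [eAdj]
      exact ⟨trivial, by omega⟩)
  have hE : earSet L base x = {x | x ∈ c.support} := by
    rw [hs]
    symm
    apply Set.eq_of_subset_of_ncard_le
    · rintro _ ⟨j, rfl⟩
      simp only [f, earSet]
      split_ifs <;> simp
    · rw [earSet_ncard, ← Set.image_univ, Set.ncard_image_of_injective _ hf, Set.ncard_univ,
        Nat.card_fin, hn]
    · exact (Set.finite_range _).insert _
  refine ⟨a, c, hc, cycle_induced hc ?_, hE⟩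
  intro v hv
  have hv' : v ∈ earSet L base x := by rw [hE]; exact hv
  rcases hv' with rfl | ⟨j, rfl⟩
  · refine ⟨Sum.inr ⟨x, ⟨0, by omega⟩⟩, Sum.inr ⟨x, ⟨L x - 1, by omega⟩⟩, ?_⟩
    intro w hw hadj
    have hw' : w ∈ earSet L base x := by rw [hE]; exact hw
    rcases hw' with rfl | ⟨j, rfl⟩
    · exact absurd rfl hadj.ne
    · obtain ⟨-, h⟩ := hadj
      dsimp only at h
      rcases h with h | h
      · left; congr 2; exact Fin.ext h
      · right; congr 2; apply Fin.ext; simp only; omega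
  · exact ⟨_, _, fun w _ hw => (eAdj_ear x j w).1 hw⟩

lemma exists_tri_cycle :
    ∃ (a : EV L) (c : (eGraph L base).Walk a a), c.IsCycle ∧
    (∀ x y, x ∈ c.support → y ∈ c.support → (eGraph L base).Adj x y → s(x, y) ∈ c.edges) ∧
    triSet L = {x | x ∈ c.support} := by
  obtain ⟨a, c, hc, hs⟩ := exists_cycle_of_hom (n := 0) (G := eGraph L base)
    (Sum.inl : Fin 3 → EV L) Sum.inl_injective (by
      intro u v h
      exact h.ne)
  refine ⟨a, c, hc, cycle_induced hc ?_, hs.symm⟩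
  intro v hv
  have hv' : v ∈ triSet L := by rw [triSet, ← hs]; exact hv
  obtain ⟨b, rfl⟩ := hv'
  refine ⟨Sum.inl (b + 1), Sum.inl (b + 2), ?_⟩
  intro w hw hadj
  have hw' : w ∈ triSet L := by rw [triSet, ← hs]; exact hw
  obtain ⟨d, rfl⟩ := hw'
  have : b ≠ d := hadj
  have key : ∀ b d : Fin 3, b ≠ d → d = b + 1 ∨ d = b + 2 := by decide
  rcases key b d this with h | h <;> simp [h]

lemma eGraph_cycleCount [Fintype I] (hL : ∀ x, 2 ≤ L x) :
    cycleCount (eGraph L base) = Fintype.card I + 1 := by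
  have hset : {S : Set (EV L) | ∃ (a : EV L) (c : (eGraph L base).Walk a a), c.IsCycle ∧
      (∀ x y, x ∈ c.support → y ∈ c.support → (eGraph L base).Adj x y → s(x, y) ∈ c.edges) ∧
      S = {x | x ∈ c.support}} =
      insert (triSet L) (Set.range (earSet L base)) := by
    ext S
    constructor
    · rintro ⟨a, c, hc, -, rfl⟩
      rcases cycle_class hL hc with h | ⟨x, h⟩
      · left; exact h
      · right; exact ⟨x, h.symm⟩
    · rintro (rfl | ⟨x, rfl⟩)
      · exact exists_tri_cycle
      · exact exists_ear_cycle hL x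
  rw [cycleCount, hset, Set.ncard_insert_of_notMem]
  · rw [← Set.image_univ, Set.ncard_image_of_injective, Set.ncard_univ, Nat.card_eq_fintype_card]
    intro x y h
    have hx := hL x
    have : (Sum.inr ⟨x, ⟨0, by omega⟩⟩ : EV L) ∈ earSet L base y := by
      rw [← h]; simp [earSet]
    rcases this with h | ⟨j, h⟩
    · simp at h
    · exact (Sigma.mk.inj (Sum.inr.inj h)).1.symm
  · rintro ⟨x, h⟩
    have hx := hL x
    have : (Sum.inr ⟨x, ⟨0, by omega⟩⟩ : EV L) ∈ triSet L := by
      rw [← h]; simp [earSet]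
    simp [triSet] at this

lemma eGraph_connected : (eGraph L base).Connected := by
  have hbig : ∀ a : Fin 3, (eGraph L base).Reachable (Sum.inl a) (Sum.inl 0) := by
    intro a
    by_cases h : a = 0
    · rw [h]
    · have h' : (eGraph L base).Adj (Sum.inl a) (Sum.inl 0) := h
      exact h'.reachable
  have hear : ∀ (x : I) (a : ℕ) (ha : a < L x),
      (eGraph L base).Reachable (Sum.inr ⟨x, ⟨a, ha⟩⟩) (Sum.inl 0) := by
    intro x a
    induction a with
    | zero =>
      intro ha
      refine SimpleGraph.Reachable.trans (SimpleGraph.Adj.reachable ?_) (hbig (base x))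
      exact ⟨rfl, Or.inl rfl⟩
    | succ a ih =>
      intro ha
      refine SimpleGraph.Reachable.trans (SimpleGraph.Adj.reachable ?_) (ih (by omega))
      exact ⟨rfl, Or.inr rfl⟩
  have hall : ∀ v, (eGraph L base).Reachable v (Sum.inl 0) := by
    rintro (a | ⟨x, j⟩)
    · exact hbig a
    · exact hear x j.1 j.2
  have : Nonempty (EV L) := ⟨Sum.inl 0⟩
  exact ⟨fun u v => (hall u).trans (hall v).symm⟩

lemma big_deg_ge [Fintype I] (a : Fin 3) :
    2 ≤ ((eGraph L base).neighborSet (Sum.inl a)).ncard := by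
  have h : ({Sum.inl (a + 1), Sum.inl (a + 2)} : Set (EV L)) ⊆
      (eGraph L base).neighborSet (Sum.inl a) := by
    have k1 : ∀ a : Fin 3, a ≠ a + 1 := by decide
    have k2 : ∀ a : Fin 3, a ≠ a + 2 := by decide
    rintro w (rfl | rfl)
    · exact k1 a
    · exact k2 a
  calc 2 = ({Sum.inl (a + 1), Sum.inl (a + 2)} : Set (EV L)).ncard := by
        rw [Set.ncard_pair]
        simp
    _ ≤ _ := Set.ncard_le_ncard h (Set.toFinite _)

lemma big_deg_ge3 [Fintype I] (hL : ∀ x, 2 ≤ L x) (x : I) :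
    3 ≤ ((eGraph L base).neighborSet (Sum.inl (base x))).ncard := by
  have hx := hL x
  generalize ha : base x = a
  have h : (insert (Sum.inr ⟨x, ⟨0, by omega⟩⟩) {Sum.inl (a + 1), Sum.inl (a + 2)} : Set (EV L)) ⊆
      (eGraph L base).neighborSet (Sum.inl a) := by
    have k1 : ∀ a : Fin 3, a ≠ a + 1 := by decide
    have k2 : ∀ a : Fin 3, a ≠ a + 2 := by decide
    rintro w (rfl | rfl | rfl)
    · exact ⟨ha, Or.inl rfl⟩
    · exact k1 a
    · exact k2 a
  calc 3 = (insert (Sum.inr ⟨x, ⟨0, by omega⟩⟩)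
          {Sum.inl (a + 1), Sum.inl (a + 2)} : Set (EV L)).ncard := by
        rw [Set.ncard_insert_of_notMem (by simp), Set.ncard_pair]
        simp
    _ ≤ _ := Set.ncard_le_ncard h (Set.toFinite _)

lemma eGraph_compact [Fintype I] (hL : ∀ x, 2 ≤ L x) (hE : ∀ x, Even (L x)) :
    IsCompactGraph (eGraph L base) := by
  refine ⟨eGraph_connected, ?_, ?_, ?_⟩
  · rintro (a | ⟨x, j⟩)
    · exact big_deg_ge a
    · exact (ear_deg hL x j).ge
  · intro a c hc
    rw [← cycle_ncard hc, Nat.not_even_iff_odd]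
    rcases cycle_class hL hc with h | ⟨x, h⟩
    · rw [h, triSet_ncard]; decide
    · rw [h, earSet_ncard]
      exact (hE x).add_one
  · intro a b c₁ c₂ h₁ h₂ _ _ hd
    have hb : ∀ (a : EV L) (c : (eGraph L base).Walk a a), c.IsCycle →
        ∃ d : Fin 3, Sum.inl d ∈ c.support := by
      intro a c hc
      rcases cycle_class hL hc with h | ⟨x, h⟩
      · refine ⟨0, ?_⟩
        change _ ∈ {z | z ∈ c.support}
        rw [h]; simp [triSet]
      · refine ⟨base x, ?_⟩
        change _ ∈ {z | z ∈ c.support}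
        rw [h]; simp [earSet]
    obtain ⟨d, hd1⟩ := hb _ _ h₁
    obtain ⟨e, he⟩ := hb _ _ h₂
    refine ⟨_, hd1, _, he, ?_⟩
    change d ≠ e
    rintro rfl
    exact hd _ hd1 he

lemma eGraph_three [Fintype I] (hL : ∀ x, 2 ≤ L x) (hb : Function.Surjective base) :
    Set.ncard {v | 3 ≤ ((eGraph L base).neighborSet v).ncard} = 3 := by
  have : {v | 3 ≤ ((eGraph L base).neighborSet v).ncard} = triSet L := by
    ext v
    rcases v with a | ⟨x, j⟩
    · obtain ⟨x, rfl⟩ := hb a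
      simpa [triSet] using big_deg_ge3 hL x
    · simp [triSet, ear_deg hL]
  rw [this, triSet_ncard]

end model

/-! ### Invariance under isomorphism. -/

section isoinv
variable {V V' : Type} {G : SimpleGraph V} {H : SimpleGraph V'}

lemma iso_deg (e : G ≃g H) (v : V) : (H.neighborSet (e v)).ncard = (G.neighborSet v).ncard := by
  have : H.neighborSet (e v) = e '' G.neighborSet v := by
    ext w
    constructor
    · intro h
      refine ⟨e.symm w, ?_, by simp⟩
      rw [SimpleGraph.mem_neighborSet, ← e.map_adj_iff]
      simpa using h
    · rintro ⟨u, hu, rfl⟩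
      exact e.map_adj_iff.2 hu
  rw [this, Set.ncard_image_of_injective _ e.injective]

lemma iso_compact (e : G ≃g H) (h : IsCompactGraph G) : IsCompactGraph H := by
  obtain ⟨h1, h2, h3, h4⟩ := h
  have hinj : Function.Injective e.symm.toHom := e.symm.injective
  refine ⟨e.connected_iff.1 h1, ?_, ?_, ?_⟩
  · intro v
    obtain ⟨u, rfl⟩ := e.surjective v
    rw [iso_deg]
    exact h2 u
  · intro a c hc
    have := h3 _ (c.map e.symm.toHom) (hc.map hinj)
    simpa using this
  · intro a b c₁ c₂ hc₁ hc₂ o₁ o₂ hd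
    obtain ⟨x, hx, y, hy, hxy⟩ := h4 _ _ (c₁.map e.symm.toHom) (c₂.map e.symm.toHom)
      (hc₁.map hinj) (hc₂.map hinj) (by simpa using o₁) (by simpa using o₂) (by
        intro x hx hx'
        rw [SimpleGraph.Walk.support_map, List.mem_map] at hx hx'
        obtain ⟨u, hu, rfl⟩ := hx
        obtain ⟨w, hw, hw'⟩ := hx'
        exact hd u hu (hinj hw' ▸ hw))
    rw [SimpleGraph.Walk.support_map, List.mem_map] at hx hy
    obtain ⟨u, hu, rfl⟩ := hx
    obtain ⟨w, hw, rfl⟩ := hy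
    exact ⟨u, hu, w, hw, e.symm.map_adj_iff.1 hxy⟩

lemma iso_three (e : G ≃g H) : Set.ncard {v | 3 ≤ (H.neighborSet v).ncard} =
    Set.ncard {v | 3 ≤ (G.neighborSet v).ncard} := by
  have : {v | 3 ≤ (H.neighborSet v).ncard} = e '' {v | 3 ≤ (G.neighborSet v).ncard} := by
    ext w
    constructor
    · intro h
      obtain ⟨u, rfl⟩ := e.surjective w
      refine ⟨u, ?_, rfl⟩
      simpa [iso_deg] using h
    · rintro ⟨u, hu, rfl⟩
      simpa [iso_deg] using hu
  rw [this, Set.ncard_image_of_injective _ e.injective]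

def indCycles (G : SimpleGraph V) : Set (Set V) :=
  {S : Set V | ∃ (a : V) (c : G.Walk a a), c.IsCycle ∧
    (∀ x y, x ∈ c.support → y ∈ c.support → G.Adj x y → s(x, y) ∈ c.edges) ∧
    S = {x | x ∈ c.support}}

lemma iso_ind (e : G ≃g H) (S : Set V) (h : S ∈ indCycles G) : e '' S ∈ indCycles H := by
  obtain ⟨a, c, hc, hi, rfl⟩ := h
  refine ⟨_, c.map e.toHom, hc.map e.injective, ?_, ?_⟩
  · intro x y hx hy hxy
    rw [SimpleGraph.Walk.support_map, List.mem_map] at hx hy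
    obtain ⟨u, hu, rfl⟩ := hx
    obtain ⟨w, hw, rfl⟩ := hy
    rw [SimpleGraph.Walk.edges_map, List.mem_map]
    exact ⟨s(u, w), hi u w hu hw (e.map_adj_iff.1 hxy), rfl⟩
  · ext x
    simp [SimpleGraph.Walk.support_map]

lemma iso_count (e : G ≃g H) : cycleCount H = cycleCount G := by
  have : indCycles H = (fun S => e '' S) '' indCycles G := by
    ext S
    constructor
    · intro h
      refine ⟨_, iso_ind e.symm S h, ?_⟩
      change e '' (e.symm '' S) = S
      rw [← Set.image_comp]
      have : (e ∘ e.symm) = id := by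
        funext x
        simp
      rw [this, Set.image_id]
    · rintro ⟨S, hS, rfl⟩
      exact iso_ind e S hS
  change (indCycles H).ncard = (indCycles G).ncard
  rw [this, Set.ncard_image_of_injective _ e.injective.image_injective]

def Good (G : SimpleGraph V) (t : ℕ) : Prop :=
  IsCompactGraph G ∧ Set.ncard {v | 3 ≤ (G.neighborSet v).ncard} = 3 ∧ cycleCount G = t

lemma Good.iso (e : G ≃g H) {t : ℕ} (h : Good G t) : Good H t :=
  ⟨iso_compact e h.1, (iso_three e).trans h.2.1, (iso_count e).trans h.2.2⟩

def indIso (e : G ≃g H) (W : Set V) : G.induce W ≃g H.induce (e '' W) where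
  toEquiv := e.toEquiv.image W
  map_rel_iff' := by
    intro a b
    exact e.map_adj_iff

end isoinv

section sub
variable {I : Type} [Fintype I] {L : I → ℕ} {base : I → Fin 3}

/-- The triangle together with the ears in `A`. -/
def Wset (L : I → ℕ) (A : Finset I) : Set (EV L) :=
  {z | ∀ y, z = Sum.inr y → y.1 ∈ A}

lemma Wset_inl (A : Finset I) (a : Fin 3) : (Sum.inl a : EV L) ∈ Wset L A := by
  intro y h
  cases h

lemma Wset_inr (A : Finset I) (x : I) (j : Fin (L x)) :
    (Sum.inr ⟨x, j⟩ : EV L) ∈ Wset L A ↔ x ∈ A := by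
  constructor
  · intro h
    exact h _ rfl
  · intro h y hy
    cases hy
    exact h

lemma Wset_inj (hL : ∀ x, 2 ≤ L x) : Function.Injective (Wset L) := by
  intro A B h
  ext x
  have hx := hL x
  rw [← Wset_inr (L := L) A x ⟨0, by omega⟩, h, Wset_inr]

def subMap (L : I → ℕ) (A : Finset I) : EV (fun x : A => L x) → Wset L A
  | Sum.inl a => ⟨Sum.inl a, Wset_inl A a⟩
  | Sum.inr z => ⟨Sum.inr ⟨z.1, z.2⟩, (Wset_inr A _ _).2 z.1.2⟩

lemma subMap_bij (A : Finset I) : Function.Bijective (subMap L A) := by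
  constructor
  · rintro (a | ⟨⟨x, hx⟩, i⟩) (b | ⟨⟨y, hy⟩, j⟩) h
    · have := congrArg Subtype.val h
      simpa [subMap] using this
    · have := congrArg Subtype.val h
      simp [subMap] at this
    · have := congrArg Subtype.val h
      simp [subMap] at this
    · have := congrArg Subtype.val h
      simp only [subMap] at this
      obtain ⟨h1, h2⟩ := Sigma.mk.inj (Sum.inr.inj this)
      subst h1
      obtain rfl := eq_of_heq h2
      rfl
  · rintro ⟨(a | ⟨x, i⟩), h⟩
    · exact ⟨Sum.inl a, rfl⟩
    · exact ⟨Sum.inr ⟨⟨x, (Wset_inr A x i).1 h⟩, i⟩, rfl⟩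

def subIso (L : I → ℕ) (base : I → Fin 3) (A : Finset I) :
    eGraph (fun x : A => L x) (fun x : A => base x) ≃g (eGraph L base).induce (Wset L A) where
  toEquiv := Equiv.ofBijective _ (subMap_bij A)
  map_rel_iff' := by
    rintro (a | ⟨⟨x, hx⟩, i⟩) (b | ⟨⟨y, hy⟩, j⟩)
    · exact Iff.rfl
    · exact Iff.rfl
    · exact Iff.rfl
    · change (x = y ∧ _) ↔ ((⟨x, hx⟩ : A) = ⟨y, hy⟩ ∧ _)
      rw [Subtype.mk.injEq]

lemma induce_deg {V : Type} (G : SimpleGraph V) (W : Set V) (v : W) :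
    ((G.induce W).neighborSet v).ncard = (G.neighborSet v ∩ W).ncard := by
  rw [← Set.ncard_image_of_injective _ Subtype.val_injective]
  congr 1
  ext w
  constructor
  · rintro ⟨u, hu, rfl⟩
    exact ⟨hu, u.2⟩
  · rintro ⟨h1, h2⟩
    exact ⟨⟨w, h2⟩, h1, rfl⟩

lemma good_iff (hL : ∀ x, 2 ≤ L x) (hE : ∀ x, Even (L x)) (t : ℕ) (W : Set (EV L)) :
    Good ((eGraph L base).induce W) (t + 1) ↔
      ∃ A : Finset I, (A.card = t ∧ ∀ b, ∃ x ∈ A, base x = b) ∧ Wset L A = W := by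
  constructor
  · intro hg
    obtain ⟨⟨-, hdeg, -, -⟩, hthree, hcount⟩ := id hg
    -- the big vertices are exactly the triangle
    have hbig : Subtype.val '' {v : W | 3 ≤ (((eGraph L base).induce W).neighborSet v).ncard} =
        triSet L := by
      apply Set.eq_of_subset_of_ncard_le
      · rintro _ ⟨⟨v, hv⟩, h, rfl⟩
        rcases v with a | ⟨x, j⟩
        · exact ⟨a, rfl⟩
        · exfalso
          have h : 3 ≤ (((eGraph L base).induce W).neighborSet ⟨Sum.inr ⟨x, j⟩, hv⟩).ncard := h
          rw [induce_deg] at h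
          have h' := Set.ncard_le_ncard (Set.inter_subset_left (s :=
            (eGraph L base).neighborSet (Sum.inr ⟨x, j⟩)) (t := W)) (Set.toFinite _)
          rw [ear_deg hL] at h'
          exact absurd (h.trans h') (by omega)
      · rw [Set.ncard_image_of_injective _ Subtype.val_injective, hthree, triSet_ncard]
      · exact Set.finite_range _
    have hear : ∀ x, ∀ j : Fin (L x), Sum.inr ⟨x, j⟩ ∈ W →
        ∀ j : Fin (L x), Sum.inr ⟨x, j⟩ ∈ W := by
      intro x j hj
      refine (ear_closed (base := base) W x j hj ?_).2
      intro j hj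
      have h := hdeg ⟨_, hj⟩
      rw [induce_deg] at h
      have h' : (eGraph L base).neighborSet (Sum.inr ⟨x, j⟩) ∩ W =
          (eGraph L base).neighborSet (Sum.inr ⟨x, j⟩) := by
        apply Set.eq_of_subset_of_ncard_le Set.inter_subset_left
        · rw [ear_deg hL]
          exact h
      rw [Set.inter_eq_left, ear_nbr] at h'
      exact ⟨h' (by simp), h' (by simp)⟩
    have hb : ∀ b : Fin 3, ∃ h : Sum.inl b ∈ W,
        3 ≤ (((eGraph L base).induce W).neighborSet ⟨Sum.inl b, h⟩).ncard := by
      intro b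
      have : (Sum.inl b : EV L) ∈ triSet L := ⟨b, rfl⟩
      rw [← hbig] at this
      obtain ⟨⟨v, hv⟩, h, h'⟩ := this
      dsimp only at h'
      subst h'
      exact ⟨hv, h⟩
    let A : Finset I := Finset.univ.filter fun x => ∃ j, (Sum.inr ⟨x, j⟩ : EV L) ∈ W
    have hW : Wset L A = W := by
      ext z
      rcases z with a | ⟨x, j⟩
      · simp [Wset_inl, (hb a).1]
      · rw [Wset_inr]
        simp only [A, Finset.mem_filter, Finset.mem_univ, true_and]
        exact ⟨fun ⟨j', h⟩ => hear x j' h j, fun h => ⟨j, h⟩⟩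
    refine ⟨A, ⟨?_, ?_⟩, hW⟩
    · have h1 := iso_count (subIso L base A)
      rw [hW, hcount, eGraph_cycleCount (L := fun x : A => L x) (fun x => hL x)] at h1
      simp at h1
      exact h1.symm
    · intro b
      by_contra! hno
      obtain ⟨hmem, hd⟩ := hb b
      rw [induce_deg] at hd
      have hsub : (eGraph L base).neighborSet (Sum.inl b) ∩ W ⊆
          {Sum.inl (b + 1), Sum.inl (b + 2)} := by
        rintro (d | ⟨x, j⟩) ⟨h1, h2⟩
        · have h1 : b ≠ d := h1
          have key : ∀ b d : Fin 3, b ≠ d → d = b + 1 ∨ d = b + 2 := by decide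
          rcases key b d h1 with h | h <;> simp [h]
        · have hxA : x ∈ A := by
            simp only [A, Finset.mem_filter, Finset.mem_univ, true_and]
            exact ⟨j, h2⟩
          exact absurd h1.1 (hno x hxA)
      have h1 := Set.ncard_le_ncard hsub (Set.toFinite _)
      have h2 : ({Sum.inl (b + 1), Sum.inl (b + 2)} : Set (EV L)).ncard ≤ 2 :=
        (Set.ncard_insert_le _ _).trans (by simp)
      have hd : 3 ≤ ((eGraph L base).neighborSet (Sum.inl b) ∩ W).ncard := hd
      omega
  · rintro ⟨A, ⟨hA, hs⟩, rfl⟩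
    refine Good.iso (subIso L base A) ⟨eGraph_compact (fun x => hL x) (fun x => hE x),
      eGraph_three (fun x => hL x) ?_, ?_⟩
    · intro b
      obtain ⟨x, hx, rfl⟩ := hs b
      exact ⟨⟨x, hx⟩, rfl⟩
    · rw [eGraph_cycleCount (L := fun x : A => L x) (fun x => hL x)]
      simp [hA]

lemma good_count (hL : ∀ x, 2 ≤ L x) (hE : ∀ x, Even (L x)) (t : ℕ) :
    Set.ncard {W : Set (EV L) | Good ((eGraph L base).induce W) (t + 1)} =
      (Finset.univ.filter fun A : Finset I =>
        A.card = t ∧ ∀ b, ∃ x ∈ A, base x = b).card := by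
  rw [← Set.ncard_coe_finset, ← Set.ncard_image_of_injective _ (Wset_inj hL)]
  congr 1
  ext W
  rw [Set.mem_ofPred_eq, good_iff hL hE]
  simp

end sub

section final
variable {m n k : ℕ}

abbrev Idx (m n k : ℕ) : Type := Fin m ⊕ (Fin n ⊕ Fin k)

def len (p : Fin m → ℕ) (q : Fin n → ℕ) (r : Fin k → ℕ) : Idx m n k → ℕ
  | Sum.inl x => 2 * p x
  | Sum.inr (Sum.inl x) => 2 * q x
  | Sum.inr (Sum.inr x) => 2 * r x

def bas : Idx m n k → Fin 3
  | Sum.inl _ => 0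
  | Sum.inr (Sum.inl _) => 1
  | Sum.inr (Sum.inr _) => 2

def toCV (p : Fin m → ℕ) (q : Fin n → ℕ) (r : Fin k → ℕ) : EV (len p q r) → CV p q r
  | Sum.inl a => Sum.inl a
  | Sum.inr ⟨Sum.inl x, j⟩ => Sum.inr (Sum.inl ⟨x, j⟩)
  | Sum.inr ⟨Sum.inr (Sum.inl x), j⟩ => Sum.inr (Sum.inr (Sum.inl ⟨x, j⟩))
  | Sum.inr ⟨Sum.inr (Sum.inr x), j⟩ => Sum.inr (Sum.inr (Sum.inr ⟨x, j⟩))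

def ofCV (p : Fin m → ℕ) (q : Fin n → ℕ) (r : Fin k → ℕ) : CV p q r → EV (len p q r)
  | Sum.inl a => Sum.inl a
  | Sum.inr (Sum.inl z) => Sum.inr ⟨Sum.inl z.1, z.2⟩
  | Sum.inr (Sum.inr (Sum.inl z)) => Sum.inr ⟨Sum.inr (Sum.inl z.1), z.2⟩
  | Sum.inr (Sum.inr (Sum.inr z)) => Sum.inr ⟨Sum.inr (Sum.inr z.1), z.2⟩

def cvEquiv (p : Fin m → ℕ) (q : Fin n → ℕ) (r : Fin k → ℕ) : CV p q r ≃ EV (len p q r) where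
  toFun := ofCV p q r
  invFun := toCV p q r
  left_inv := by rintro (a | ⟨x, j⟩ | ⟨x, j⟩ | ⟨x, j⟩) <;> rfl
  right_inv := by rintro (a | ⟨x | x | x, j⟩) <;> rfl

lemma sigma_ne_aux {N : ℕ} {f : Fin N → ℕ} {x y : Fin N} {i : Fin (f x)} {j : Fin (f y)}
    (h : (i : ℕ) ≠ j) : (⟨x, i⟩ : Σ x, Fin (f x)) ≠ ⟨y, j⟩ := by
  intro h'
  cases h'
  exact h rfl

lemma ear_adj_aux {N : ℕ} {f : Fin N → ℕ} {x y : Fin N} {i : Fin (f x)} {j : Fin (f y)} :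
    (x = y ∧ ((j : ℕ) = i + 1 ∨ (i : ℕ) = j + 1)) ↔
    ((⟨x, i⟩ : Σ x, Fin (f x)) ≠ ⟨y, j⟩ ∧
      (((x : ℕ) = y ∧ (j : ℕ) = i + 1) ∨ ((y : ℕ) = x ∧ (i : ℕ) = j + 1))) := by
  constructor
  · rintro ⟨rfl, h⟩
    exact ⟨sigma_ne_aux (by omega), by omega⟩
  · rintro ⟨-, h⟩
    refine ⟨Fin.ext (by omega), by omega⟩

def cvIso (p : Fin m → ℕ) (q : Fin n → ℕ) (r : Fin k → ℕ) :
    typeThree p q r ≃g eGraph (len p q r) bas where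
  toEquiv := cvEquiv p q r
  map_rel_iff' := by
    intro a b
    change eAdj (len p q r) bas (ofCV p q r a) (ofCV p q r b) ↔ (typeThree p q r).Adj a b
    rw [typeThree, SimpleGraph.fromRel_adj]
    rcases a with a | ⟨x, i⟩ | ⟨x, i⟩ | ⟨x, i⟩ <;> rcases b with b | ⟨y, j⟩ | ⟨y, j⟩ | ⟨y, j⟩ <;>
      simp only [ofCV, eAdj, cRel, bas, len, ne_eq, Sum.inl.injEq, Sum.inr.injEq, reduceCtorEq,
        not_false_eq_true, true_and, or_false, false_or, and_false, false_and]
    · fin_cases a <;> fin_cases b <;> simp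
    · rw [eq_comm]
    · rw [eq_comm]
    · rw [eq_comm]
    · rw [eq_comm]
    · exact ear_adj_aux (f := fun x => 2 * p x)
    · rw [eq_comm]
    · exact ear_adj_aux (f := fun x => 2 * q x)
    · rw [eq_comm]
    · exact ear_adj_aux (f := fun x => 2 * r x)

lemma comb_count (i : ℕ) :
    (Finset.univ.filter fun A : Finset (Idx m n k) =>
        A.card = i + 1 ∧ ∀ b, ∃ x ∈ A, bas x = b).card =
      ∑ a ∈ Finset.Icc 1 i, ∑ b ∈ Finset.Icc 1 (i - a),
        Nat.choose m a * Nat.choose n b * Nat.choose k (i + 1 - a - b) := by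
  have hT : (((Finset.Icc 1 i).sigma fun a => (Finset.Icc 1 (i - a)).sigma fun b =>
      (Finset.powersetCard a (Finset.univ : Finset (Fin m))) ×ˢ
      ((Finset.powersetCard b (Finset.univ : Finset (Fin n))) ×ˢ
      (Finset.powersetCard (i + 1 - a - b) (Finset.univ : Finset (Fin k)))))).card =
      ∑ a ∈ Finset.Icc 1 i, ∑ b ∈ Finset.Icc 1 (i - a),
        Nat.choose m a * Nat.choose n b * Nat.choose k (i + 1 - a - b) := by
    simp [Finset.card_sigma, mul_assoc]
  rw [← hT]
  have hcard : ∀ A : Finset (Idx m n k), A.card =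
      A.toLeft.card + (A.toRight.toLeft.card + A.toRight.toRight.card) := by
    intro A
    rw [Finset.card_toLeft_add_card_toRight, Finset.card_toLeft_add_card_toRight]
  have hsurj : ∀ A : Finset (Idx m n k), (∀ b, ∃ x ∈ A, bas x = b) ↔
      (1 ≤ A.toLeft.card ∧ 1 ≤ A.toRight.toLeft.card ∧ 1 ≤ A.toRight.toRight.card) := by
    intro A
    simp only [Nat.one_le_iff_ne_zero, ← Nat.pos_iff_ne_zero, Finset.card_pos, Finset.Nonempty,
      Finset.mem_toLeft, Finset.mem_toRight]
    constructor
    · intro h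
      refine ⟨?_, ?_, ?_⟩
      · obtain ⟨x | x | x, hx, h⟩ := h 0
        · exact ⟨x, hx⟩
        · simp [bas] at h
        · simp [bas] at h
      · obtain ⟨x | x | x, hx, h⟩ := h 1
        · simp [bas] at h
        · exact ⟨x, hx⟩
        · simp [bas] at h
      · obtain ⟨x | x | x, hx, h⟩ := h 2
        · simp [bas] at h
        · simp [bas] at h
        · exact ⟨x, hx⟩
    · rintro ⟨⟨x, hx⟩, ⟨y, hy⟩, ⟨z, hz⟩⟩ b
      fin_cases b
      · exact ⟨_, hx, rfl⟩
      · exact ⟨_, hy, rfl⟩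
      · exact ⟨_, hz, rfl⟩
  refine Finset.card_bij'
    (fun A _ => ⟨A.toLeft.card, A.toRight.toLeft.card,
      (A.toLeft, A.toRight.toLeft, A.toRight.toRight)⟩)
    (fun T _ => T.2.2.1.disjSum (T.2.2.2.1.disjSum T.2.2.2.2)) ?_ ?_ ?_ ?_
  · intro A hA
    simp only [Finset.mem_filter, Finset.mem_univ, true_and, hsurj, hcard] at hA
    simp only [Finset.mem_sigma, Finset.mem_Icc, Finset.mem_product, Finset.mem_powersetCard,
      Finset.subset_univ, true_and]
    omega
  · rintro ⟨a, b, X, Y, Z⟩ hA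
    simp only [Finset.mem_sigma, Finset.mem_Icc, Finset.mem_product, Finset.mem_powersetCard,
      Finset.subset_univ, true_and] at hA
    simp only [Finset.mem_filter, Finset.mem_univ, true_and, hsurj, hcard,
      Finset.toLeft_disjSum, Finset.toRight_disjSum]
    omega
  · intro A hA
    simp [Finset.toLeft_disjSum_toRight]
  · rintro ⟨a, b, X, Y, Z⟩ hA
    simp only [Finset.mem_sigma, Finset.mem_Icc, Finset.mem_product, Finset.mem_powersetCard,
      Finset.subset_univ, true_and] at hA
    obtain ⟨-, -, rfl, rfl, -⟩ := hA
    simp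

end final

/-- The number of vertex subsets of `C_{p:q:r}` inducing a compact graph
of type 3 (exactly three vertices of degree at least 3) with exactly `i+2` minimal
cycles. -/
theorem statement15 (m n k : ℕ) (p : Fin m → ℕ) (q : Fin n → ℕ) (r : Fin k → ℕ)
    (hp : ∀ i, 1 ≤ p i) (hq : ∀ i, 1 ≤ q i) (hr : ∀ i, 1 ≤ r i) (i : ℕ) (hi : 1 ≤ i) :
    Set.ncard {W : Set (CV p q r) |
        IsCompactGraph ((typeThree p q r).induce W) ∧
        Set.ncard {v : W | 3 ≤ (((typeThree p q r).induce W).neighborSet v).ncard} = 3 ∧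
        cycleCount ((typeThree p q r).induce W) = i + 2} =
      ∑ a ∈ Finset.Icc 1 i, ∑ b ∈ Finset.Icc 1 (i - a),
        Nat.choose m a * Nat.choose n b * Nat.choose k (i + 1 - a - b) := by
  have hL : ∀ x, 2 ≤ len p q r x := by
    rintro (x | x | x)
    · have := hp x
      simp only [len]; omega
    · have := hq x
      simp only [len]; omega
    · have := hr x
      simp only [len]; omega
  have hE : ∀ x, Even (len p q r x) := by
    rintro (x | x | x) <;> exact even_two_mul _
  rw [← comb_count, ← good_count (L := len p q r) hL hE]
  rw [← Set.ncard_image_of_injective _ (cvIso p q r).injective.image_injective]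
  congr 1
  ext W
  constructor
  · rintro ⟨W, hW, rfl⟩
    exact Good.iso (indIso (cvIso p q r) W) hW
  · intro hW
    obtain ⟨W, rfl⟩ := (cvIso p q r).surjective.image_surjective W
    exact ⟨W, Good.iso (indIso (cvIso p q r) W).symm hW, rfl⟩

end Paper
end
end

section
/- Let K be a field, m ≥ 2 and ℓ = (ℓ_1,…,ℓ_m) ∈ ℤ_{>0}^m. Let G = G_{2ℓ+1} be the odd multi-path graph and let A = A_ℓ be the compact graph of type 1 with vertex set {u} ∪ {u_{i,j} : 1 ≤ i ≤ m, 1 ≤ j ≤ 2ℓ_i} and edges {u_{i,j}, u_{i,j+1}} (1 ≤ j ≤ 2ℓ_i−1), {u, u_{i,1}} and {u, u_{i,2ℓ_i}} for each i. Consider the bijection E(G) → E(A) sending {v1, u_{i,1}} to {u, u_{i,1}}, each edge {u_{i,j}, u_{i,j+1}} to itself, and {u_{i,2ℓ_i}, v2} to {u_{i,2ℓ_i}, u}. Then the induced K-algebra isomorphism of polynomial rings K[E(G)] → K[E(A)] maps the toric ideal I_G onto the toric ideal I_A; consequently the edge rings K[G] and K[A] are isomorphic as K-algebras. -/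
open CategoryTheory MvPolynomial Finset
open scoped Classical

noncomputable section

namespace Paper

/-- Vertices of the compact graph of type 1, `A_ℓ`: the big vertex `u = Sum.inl ()` and
the interior vertices `u_{i,j}` of the odd cycles. -/
abbrev AV {m : ℕ} (c : Fin m → ℕ) : Type := Unit ⊕ (Σ i : Fin m, Fin (c i))

def aRel {m : ℕ} (c : Fin m → ℕ) : AV c → AV c → Prop
  | Sum.inl _, Sum.inr ⟨i, j⟩ => (j : ℕ) = 0 ∨ (j : ℕ) + 1 = c i
  | Sum.inr ⟨i, j⟩, Sum.inr ⟨i', j'⟩ => (i : ℕ) = i' ∧ (j' : ℕ) = (j : ℕ) + 1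
  | _, _ => False

/-- The compact graph of type 1, `A_ℓ` (where `c i = 2ℓ_i` is the number of non-big
vertices of the `i`-th odd cycle, which has length `c i + 1`). -/
def typeOne {m : ℕ} (c : Fin m → ℕ) : SimpleGraph (AV c) := SimpleGraph.fromRel (aRel c)

/-- The vertex map `G_{2ℓ+1} → A_ℓ` sending both `v1` and `v2` to `u` and fixing the
`u_{i,j}`. -/
def collapse {m : ℕ} (c : Fin m → ℕ) : MPV c → AV c
  | Sum.inl _ => Sum.inl ()
  | Sum.inr x => Sum.inr x

theorem mp_adj_inl_inr {m : ℕ} (c : Fin m → ℕ) (a : Fin 2) (x : Σ i : Fin m, Fin (c i)) :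
    (multiPath c).Adj (Sum.inl a) (Sum.inr x) ↔
      (a = 0 ∧ (x.2 : ℕ) = 0) ∨ (a = 1 ∧ (x.2 : ℕ) + 1 = c x.1) := by
  obtain ⟨i, j⟩ := x
  simp [multiPath, mpRel]

theorem mp_adj_inl_inl {m : ℕ} (c : Fin m → ℕ) (a b : Fin 2) :
    ¬ (multiPath c).Adj (Sum.inl a) (Sum.inl b) := by
  simp [multiPath, mpRel]

theorem mp_adj_inr_inr {m : ℕ} (c : Fin m → ℕ) (x y : Σ i : Fin m, Fin (c i)) :
    (multiPath c).Adj (Sum.inr x) (Sum.inr y) ↔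
      (x.1 = y.1 ∧ ((y.2 : ℕ) = (x.2 : ℕ) + 1 ∨ (x.2 : ℕ) = (y.2 : ℕ) + 1)) := by
  obtain ⟨i, j⟩ := x
  obtain ⟨i', j'⟩ := y
  simp only [multiPath, SimpleGraph.fromRel_adj, mpRel, ne_eq, Sum.inr.injEq, Fin.ext_iff]
  constructor
  · rintro ⟨-, h | h⟩ <;> omega
  · rintro ⟨h, h'⟩
    refine ⟨?_, by omega⟩
    intro he
    cases he
    omega

theorem a_adj_inl_inr {m : ℕ} (c : Fin m → ℕ) (a : Unit) (x : Σ i : Fin m, Fin (c i)) :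
    (typeOne c).Adj (Sum.inl a) (Sum.inr x) ↔
      ((x.2 : ℕ) = 0) ∨ ((x.2 : ℕ) + 1 = c x.1) := by
  obtain ⟨i, j⟩ := x
  simp [typeOne, aRel]

theorem a_adj_inl_inl {m : ℕ} (c : Fin m → ℕ) (a b : Unit) :
    ¬ (typeOne c).Adj (Sum.inl a) (Sum.inl b) := by
  simp [typeOne]

theorem a_adj_inr_inr {m : ℕ} (c : Fin m → ℕ) (x y : Σ i : Fin m, Fin (c i)) :
    (typeOne c).Adj (Sum.inr x) (Sum.inr y) ↔ (multiPath c).Adj (Sum.inr x) (Sum.inr y) := by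
  obtain ⟨i, j⟩ := x
  obtain ⟨i', j'⟩ := y
  simp [typeOne, aRel, multiPath, mpRel]

/-- Adjacent vertices of the multi-path graph are determined by their images. -/
theorem collapse_inj_aux {m : ℕ} (ℓ : Fin m → ℕ) (hℓ : ∀ i, 1 ≤ ℓ i)
    (a b a' b' : MPV (fun i => 2 * ℓ i))
    (h : (multiPath (fun i => 2 * ℓ i)).Adj a b) (h' : (multiPath (fun i => 2 * ℓ i)).Adj a' b')
    (ha : collapse (fun i => 2 * ℓ i) a = collapse (fun i => 2 * ℓ i) a')
    (hb : collapse (fun i => 2 * ℓ i) b = collapse (fun i => 2 * ℓ i) b') :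
    a = a' ∧ b = b' := by
  have key : ∀ (a a' : Fin 2) (x : Σ i : Fin m, Fin (2 * ℓ i)),
      (multiPath (fun i => 2 * ℓ i)).Adj (Sum.inl a) (Sum.inr x) →
      (multiPath (fun i => 2 * ℓ i)).Adj (Sum.inl a') (Sum.inr x) → a = a' := by
    intro a a' x h h'
    rw [mp_adj_inl_inr] at h h'
    have := hℓ x.1
    rcases h with ⟨h1, h2⟩ | ⟨h1, h2⟩ <;> rcases h' with ⟨h3, h4⟩ | ⟨h3, h4⟩
    · rw [h1, h3]
    · omega
    · omega
    · rw [h1, h3]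
  rcases a with a | x <;> rcases a' with a' | x' <;> rcases b with b | y <;>
    rcases b' with b' | y' <;> simp only [collapse, Sum.inr.injEq, reduceCtorEq] at ha hb
  · exact absurd h (mp_adj_inl_inl _ _ _)
  · subst hb
    exact ⟨by rw [key _ _ _ h h'], rfl⟩
  · subst ha
    exact ⟨rfl, by rw [key _ _ _ h.symm h'.symm]⟩
  · subst ha hb
    exact ⟨rfl, rfl⟩

/-- The value at an interior vertex / big vertex of the map to the fraction field. -/
def psiVal (K : Type*) [Field K] {m : ℕ} (c : Fin m → ℕ) :
    AV c → FractionRing (MvPolynomial (MPV c) K)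
  | Sum.inl _ => algebraMap (MvPolynomial (MPV c) K) _ (X (Sum.inl 0) * X (Sum.inl 1))
  | Sum.inr x =>
    algebraMap (MvPolynomial (MPV c) K) _ (X (Sum.inr x) ^ 2) *
      if (x.2 : ℕ) % 2 = 0 then
        algebraMap (MvPolynomial (MPV c) K) _ (X (Sum.inl 0)) /
          algebraMap (MvPolynomial (MPV c) K) _ (X (Sum.inl 1))
      else
        algebraMap (MvPolynomial (MPV c) K) _ (X (Sum.inl 1)) /
          algebraMap (MvPolynomial (MPV c) K) _ (X (Sum.inl 0))

theorem psi_edge (K : Type*) [Field K] {m : ℕ} (ℓ : Fin m → ℕ)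
    (a b : MPV (fun i => 2 * ℓ i)) (h : (multiPath (fun i => 2 * ℓ i)).Adj a b) :
    psiVal K _ (collapse _ a) * psiVal K _ (collapse _ b) =
      algebraMap (MvPolynomial (MPV (fun i => 2 * ℓ i)) K) _ (X a ^ 2 * X b ^ 2) := by
  have hne : ∀ v : MPV (fun i => 2 * ℓ i),
      algebraMap (MvPolynomial (MPV (fun i => 2 * ℓ i)) K)
        (FractionRing (MvPolynomial (MPV (fun i => 2 * ℓ i)) K)) (X v) ≠ 0 := by
    intro v hv
    exact X_ne_zero v ((IsFractionRing.to_map_eq_zero_iff).1 hv)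
  have h0 := hne (Sum.inl 0)
  have h1 := hne (Sum.inl 1)
  have key : ∀ (a : Fin 2) (x : Σ i : Fin m, Fin (2 * ℓ i)),
      (multiPath (fun i => 2 * ℓ i)).Adj (Sum.inl a) (Sum.inr x) →
      psiVal K _ (collapse _ (Sum.inl a)) * psiVal K _ (collapse _ (Sum.inr x)) =
      algebraMap (MvPolynomial (MPV (fun i => 2 * ℓ i)) K) _
        (X (Sum.inl a) ^ 2 * X (Sum.inr x) ^ 2) := by
    intro a x h
    rw [mp_adj_inl_inr] at h
    rcases h with ⟨rfl, h2⟩ | ⟨rfl, h2⟩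
    · have : (x.2 : ℕ) % 2 = 0 := by omega
      simp only [collapse, psiVal, this, if_true, map_mul, map_pow]
      field_simp
    · have : ¬ (x.2 : ℕ) % 2 = 0 := by omega
      simp only [collapse, psiVal, this, if_false, map_mul, map_pow]
      field_simp
  rcases a with a | x <;> rcases b with b | y
  · exact absurd h (mp_adj_inl_inl _ _ _)
  · exact key _ _ h
  · rw [mul_comm, key _ _ h.symm, mul_comm]
  · rw [mp_adj_inr_inr] at h
    by_cases hx : (x.2 : ℕ) % 2 = 0
    · have hy : ¬ (y.2 : ℕ) % 2 = 0 := by omega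
      simp only [collapse, psiVal, hx, hy, if_true, if_false, map_mul, map_pow]
      field_simp
    · have hy : (y.2 : ℕ) % 2 = 0 := by omega
      simp only [collapse, psiVal, hx, hy, if_true, if_false, map_mul, map_pow]
      field_simp

theorem expand_two_inj (K : Type*) [Field K] (σ : Type*) (p : MvPolynomial σ K)
    (h : expand 2 p = 0) : p = 0 :=
  (expand_eq_zero (by norm_num)).1 h

/-- The bijection `E(G_{2ℓ+1}) → E(A_ℓ)` induced by `collapse` maps the
toric ideal of `G_{2ℓ+1}` onto that of `A_ℓ`, and the edge rings are isomorphic. -/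
theorem statement16 (K : Type*) [Field K] (m : ℕ) (hm : 2 ≤ m) (ℓ : Fin m → ℕ)
    (hℓ : ∀ i, 1 ≤ ℓ i)
    (φ : multiPath (fun i => 2 * ℓ i) →g typeOne (fun i => 2 * ℓ i))
    (hφ : ∀ x, φ x = collapse (fun i => 2 * ℓ i) x) :
    Function.Bijective (SimpleGraph.Hom.mapEdgeSet φ) ∧
      Ideal.map (rename (SimpleGraph.Hom.mapEdgeSet φ) :
          MvPolynomial (multiPath (fun i => 2 * ℓ i)).edgeSet K →ₐ[K]
            MvPolynomial (typeOne (fun i => 2 * ℓ i)).edgeSet K)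
        (toricIdeal K (multiPath (fun i => 2 * ℓ i))) =
        toricIdeal K (typeOne (fun i => 2 * ℓ i)) ∧
      Nonempty (edgeRing K (multiPath (fun i => 2 * ℓ i)) ≃ₐ[K]
        edgeRing K (typeOne (fun i => 2 * ℓ i))) := by
  have hbij : Function.Bijective (SimpleGraph.Hom.mapEdgeSet φ) := by
    constructor
    · rintro ⟨e, he⟩ ⟨e', he'⟩ h
      induction e using Sym2.ind with | _ a b => ?_
      induction e' using Sym2.ind with | _ a' b' => ?_
      rw [SimpleGraph.mem_edgeSet] at he he'
      have h2 : s(φ a, φ b) = s(φ a', φ b') := congrArg Subtype.val h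
      simp only [hφ, Sym2.eq_iff] at h2
      apply Subtype.ext
      show s(a, b) = s(a', b')
      rw [Sym2.eq_iff]
      rcases h2 with ⟨h3, h4⟩ | ⟨h3, h4⟩
      · exact Or.inl (collapse_inj_aux ℓ hℓ _ _ _ _ he he' h3 h4)
      · exact Or.inr (collapse_inj_aux ℓ hℓ _ _ _ _ he he'.symm h3 h4)
    · have main : ∀ a b, (typeOne (fun i => 2 * ℓ i)).Adj a b →
          ∃ a' b', (multiPath (fun i => 2 * ℓ i)).Adj a' b' ∧ φ a' = a ∧ φ b' = b := by
        have key : ∀ a x, (typeOne (fun i => 2 * ℓ i)).Adj (Sum.inl a) (Sum.inr x) →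
            ∃ a', (multiPath (fun i => 2 * ℓ i)).Adj (Sum.inl a') (Sum.inr x) := by
          intro a x h
          rw [a_adj_inl_inr] at h
          rcases h with h | h
          · exact ⟨0, (mp_adj_inl_inr _ _ _).2 (Or.inl ⟨rfl, h⟩)⟩
          · exact ⟨1, (mp_adj_inl_inr _ _ _).2 (Or.inr ⟨rfl, h⟩)⟩
        rintro (a | x) (b | y) h
        · exact absurd h (a_adj_inl_inl _ _ _)
        · obtain ⟨a', h'⟩ := key _ _ h
          exact ⟨_, _, h', by rw [hφ]; rfl, by rw [hφ]; rfl⟩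
        · obtain ⟨a', h'⟩ := key _ _ h.symm
          exact ⟨_, _, h'.symm, by rw [hφ]; rfl, by rw [hφ]; rfl⟩
        · exact ⟨_, _, (a_adj_inr_inr _ _ _).1 h, by rw [hφ]; rfl, by rw [hφ]; rfl⟩
      rintro ⟨e, he⟩
      induction e using Sym2.ind with | _ a b => ?_
      obtain ⟨a', b', h, rfl, rfl⟩ := main a b he
      exact ⟨⟨s(a', b'), h⟩, rfl⟩
  have hfwd : ∀ f, edgeHom K (typeOne (fun i => 2 * ℓ i))
      (rename (SimpleGraph.Hom.mapEdgeSet φ) f) =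
      rename φ (edgeHom K (multiPath (fun i => 2 * ℓ i)) f) := by
    intro f
    have : (edgeHom K (typeOne (fun i => 2 * ℓ i))).comp
        (rename (SimpleGraph.Hom.mapEdgeSet φ)) =
        (rename φ).comp (edgeHom K (multiPath (fun i => 2 * ℓ i))) := by
      apply MvPolynomial.algHom_ext
      rintro ⟨e, he⟩
      induction e using Sym2.ind with | _ a b => ?_
      simp only [AlgHom.comp_apply, rename_X, edgeHom, aeval_X]
      show edgeMon K s(φ a, φ b) = rename φ (edgeMon K s(a, b))
      simp [edgeMon]
    exact DFunLike.congr_fun this f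
  have hbwd : ∀ f, aeval (psiVal K (fun i => 2 * ℓ i)) (edgeHom K (typeOne (fun i => 2 * ℓ i))
      (rename (SimpleGraph.Hom.mapEdgeSet φ) f)) =
      algebraMap (MvPolynomial (MPV (fun i => 2 * ℓ i)) K)
        (FractionRing (MvPolynomial (MPV (fun i => 2 * ℓ i)) K))
        (expand 2 (edgeHom K (multiPath (fun i => 2 * ℓ i)) f)) := by
    intro f
    have : ((aeval (R := K) (psiVal K (fun i => 2 * ℓ i))).comp
        (edgeHom K (typeOne (fun i => 2 * ℓ i)))).comp
        (rename (SimpleGraph.Hom.mapEdgeSet φ)) =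
        ((IsScalarTower.toAlgHom K (MvPolynomial (MPV (fun i => 2 * ℓ i)) K)
          (FractionRing (MvPolynomial (MPV (fun i => 2 * ℓ i)) K))).comp
          (expand 2)).comp (edgeHom K (multiPath (fun i => 2 * ℓ i))) := by
      apply MvPolynomial.algHom_ext
      rintro ⟨e, he⟩
      induction e using Sym2.ind with | _ a b => ?_
      simp only [AlgHom.comp_apply, rename_X, edgeHom, aeval_X]
      show aeval (psiVal K (fun i => 2 * ℓ i)) (edgeMon K s(φ a, φ b)) =
        algebraMap _ _ (expand 2 (edgeMon K s(a, b)))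
      have := psi_edge K ℓ a b he
      simp only [edgeMon, Sym2.lift_mk, map_mul, aeval_X, expand_X, hφ] at this ⊢
      exact this
    exact DFunLike.congr_fun this f
  have hmem : ∀ f, rename (SimpleGraph.Hom.mapEdgeSet φ) f ∈
      toricIdeal K (typeOne (fun i => 2 * ℓ i)) ↔
      f ∈ toricIdeal K (multiPath (fun i => 2 * ℓ i)) := by
    intro f
    show edgeHom K _ _ = 0 ↔ edgeHom K _ _ = 0
    constructor
    · intro h
      have h2 := hbwd f
      rw [h, map_zero] at h2
      exact expand_two_inj _ _ _ ((IsFractionRing.to_map_eq_zero_iff).1 h2.symm)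
    · intro h
      rw [hfwd, h, map_zero]
  have hmap : Ideal.map (rename (SimpleGraph.Hom.mapEdgeSet φ) :
          MvPolynomial (multiPath (fun i => 2 * ℓ i)).edgeSet K →ₐ[K]
            MvPolynomial (typeOne (fun i => 2 * ℓ i)).edgeSet K)
        (toricIdeal K (multiPath (fun i => 2 * ℓ i))) =
        toricIdeal K (typeOne (fun i => 2 * ℓ i)) := by
    apply le_antisymm
    · rw [Ideal.map_le_iff_le_comap]
      intro f hf
      exact (hmem f).2 hf
    · intro g hg
      obtain ⟨f, rfl⟩ := rename_surjective _ hbij.2 g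
      exact Ideal.mem_map_of_mem _ ((hmem f).1 hg)
  refine ⟨hbij, hmap, ⟨Ideal.quotientEquivAlg _ _
    (renameEquiv K (Equiv.ofBijective _ hbij)) ?_⟩⟩
  rw [← hmap]
  rfl


end Paper
end
end
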